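/- Let n > 2 and q a primitive n-th root of unity. Let V = k{x,y} be the two-dimensional Yetter–Drinfeld module over kC_n (C_n = ⟨g⟩) with g·x = qx, g·y = q^{-1}y, δ(x) = g^{-1}⊗x, δ(y) = g^{-1}⊗y, so that the book Hopf algebra ℋ(1,q) equals 𝔅(V)#kC_n and 𝔅(V) has relations xⁿ = 0 = yⁿ, xy = q yx. If K = ⊕_{i=0}^{n-1} K(i) ⊆ 𝔅(V) is a homogeneous left coideal subalgebra of ℋ(1,q), i.e. K is a graded subalgebra with K(j) ⊆ 𝔅^j(V) and Δ(K(j)) ⊆ ⊕_{i=0}^{j} ℋ(1,q)(i) ⊗ K(j−i) for all j, then K is generated as an algebra by K(1). In particular, if dim K(1) = 1 with K(1) spanned by w = ax + by, then K(m) = k·w^m for all m. -/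

import Mathlib

open TensorProduct

noncomputable section

namespace HopfPaper

variable (k : Type) [CommRing k]

/-- The image submodule `p ⊗ q ⊆ M ⊗ N` of a pair of submodules. -/
def tsub {M N : Type} [AddCommGroup M] [Module k M] [AddCommGroup N] [Module k N]
    (p : Submodule k M) (q : Submodule k N) : Submodule k (M ⊗[k] N) :=
  LinearMap.range (TensorProduct.mapIncl p q)

/-- A left `H`-comodule algebra structure on the `k`-algebra `A`:
an algebra map `λ : A → H ⊗ A` which is coassociative and counital. -/
structure ComodAlg (H A : Type) [Ring H] [HopfAlgebra k H] [Ring A] [Algebra k A] where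
  lam : A →ₐ[k] H ⊗[k] A
  coassoc : (Coalgebra.comul (R := k) (A := H)).rTensor A ∘ₗ lam.toLinearMap
      = (TensorProduct.assoc k H H A).symm.toLinearMap ∘ₗ
          lam.toLinearMap.lTensor H ∘ₗ lam.toLinearMap
  counital : (Coalgebra.counit (R := k) (A := H)).rTensor A ∘ₗ lam.toLinearMap
      = TensorProduct.mk k k A 1

variable {k}

/-- A right ideal of `A` which is costable under the coaction, i.e. `λ(J) ⊆ H ⊗ J`. -/
def ComodAlg.IsCostableRightIdeal {H A : Type} [Ring H] [HopfAlgebra k H] [Ring A] [Algebra k A]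
    (c : ComodAlg k H A) (J : Submodule k A) : Prop :=
  (∀ j ∈ J, ∀ a : A, j * a ∈ J) ∧
    Submodule.map c.lam.toLinearMap J ≤ tsub k (⊤ : Submodule k H) J

/-- `A` is right `H`-simple: it has no nontrivial `H`-costable right ideal. -/
def ComodAlg.RightSimple {H A : Type} [Ring H] [HopfAlgebra k H] [Ring A] [Algebra k A]
    (c : ComodAlg k H A) : Prop :=
  ∀ J : Submodule k A, c.IsCostableRightIdeal J → J = ⊥ ∨ J = ⊤

/-- The coinvariants of `A` are trivial: `A^{co H} = k`. -/
def ComodAlg.TrivialCoinv {H A : Type} [Ring H] [HopfAlgebra k H] [Ring A] [Algebra k A]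
    (c : ComodAlg k H A) : Prop :=
  ∀ a : A, c.lam a = 1 ⊗ₜ[k] a ↔ ∃ t : k, a = t • (1 : A)

end HopfPaper

namespace HopfPaper

/-- The defining relations, coproducts and PBW basis of the book Hopf algebra. -/
structure IsBook {k : Type} [Field k] {H : Type} [Ring H] [HopfAlgebra k H]
    (n : ℕ) (q : k) (g x y : H) : Prop where
  two_lt : 2 < n
  prim : IsPrimitiveRoot q n
  gx : g * x = q • (x * g)
  gy : g * y = q⁻¹ • (y * g)
  xy : x * y = q • (y * x)
  gn : g ^ n = 1
  xn : x ^ n = 0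
  yn : y ^ n = 0
  comul_x : Coalgebra.comul (R := k) x = x ⊗ₜ[k] 1 + (g ^ (n - 1)) ⊗ₜ[k] x
  comul_y : Coalgebra.comul (R := k) y = y ⊗ₜ[k] 1 + (g ^ (n - 1)) ⊗ₜ[k] y
  counit_g : Coalgebra.counit (R := k) g = 1
  counit_x : Coalgebra.counit (R := k) x = 0
  counit_y : Coalgebra.counit (R := k) y = 0
  indep : LinearIndependent k
    (fun t : Fin n × Fin n × Fin n => g ^ (t.1 : ℕ) * y ^ (t.2.1 : ℕ) * x ^ (t.2.2 : ℕ))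
  span : Submodule.span k
    (Set.range (fun t : Fin n × Fin n × Fin n =>
      g ^ (t.1 : ℕ) * y ^ (t.2.1 : ℕ) * x ^ (t.2.2 : ℕ))) = ⊤

section

variable {k : Type} [Field k] {H : Type} [Ring H] [HopfAlgebra k H]

/-- Slicing the coproduct with a functional `ψ` on the right tensor factor. -/
noncomputable def slice (ψ : H →ₗ[k] k) : H →ₗ[k] H :=
  (TensorProduct.rid k H).toLinearMap ∘ₗ ψ.lTensor H ∘ₗ Coalgebra.comul

theorem slice_mul {u v G : H} {p : k} {ψ : H →ₗ[k] k}
    (hv : Coalgebra.comul (R := k) v = v ⊗ₜ[k] 1 + G ⊗ₜ[k] v)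
    (hψ : ∀ h, ψ (h * v) = Coalgebra.counit (R := k) h * p) :
    slice ψ (u * v) = slice ψ u * v + p • (u * G) := by
  have key : ∀ t : H ⊗[k] H,
      TensorProduct.rid k H (ψ.lTensor H (t * (v ⊗ₜ[k] 1 + G ⊗ₜ[k] v)))
        = TensorProduct.rid k H (ψ.lTensor H t) * v
          + p • (TensorProduct.rid k H ((Coalgebra.counit (R := k)).lTensor H t) * G) := by
    intro t
    induction t with
    | zero => simp
    | tmul a b => simp [mul_add, hψ, smul_smul, mul_comm]
    | add a b ha hb =>
      rw [add_mul, map_add, map_add, ha, hb]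
      simp only [map_add, add_mul, smul_add]
      abel
  have h := key (Coalgebra.comul (R := k) u)
  rw [Coalgebra.lTensor_counit_comul] at h
  simpa [slice, hv] using h

theorem slice_eq_zero {ψ : H →ₗ[k] k} {z : H} {m : ℕ} {A B : ℕ → Submodule k H}
    (hz : Coalgebra.comul (R := k) z ∈ ⨆ i ∈ Finset.range (m + 1), tsub k (A i) (B (m - i)))
    (hB : ∀ j ≤ m, ∀ b ∈ B j, ψ b = 0) : slice ψ z = 0 := by
  have hle : (⨆ i ∈ Finset.range (m + 1), tsub k (A i) (B (m - i)))
      ≤ LinearMap.ker ((TensorProduct.rid k H).toLinearMap ∘ₗ ψ.lTensor H) := by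
    refine iSup₂_le fun i _ => ?_
    rintro _ ⟨t, rfl⟩
    rw [LinearMap.mem_ker]
    induction t with
    | zero => simp
    | tmul a b => simp [TensorProduct.mapIncl, hB (m - i) (Nat.sub_le _ _) b b.2]
    | add a b ha hb => rw [map_add, map_add, ha, hb, add_zero]
  exact hle hz

namespace IsBook

variable {n : ℕ} {q : k} {g x y : H}

theorem ne_zero (h : IsBook n q g x y) : q ≠ 0 :=
  h.prim.ne_zero (by have := h.two_lt; omega)

theorem exists_functional (h : IsBook n q g x y) (f : ℕ → ℕ → ℕ → k) :
    ∃ φ : H →ₗ[k] k, ∀ a b c, a < n → b < n → c < n → φ (g ^ a * y ^ b * x ^ c) = f a b c := by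
  refine ⟨(Module.Basis.mk h.indep h.span.ge).constr k fun t => f t.1 t.2.1 t.2.2,
    fun a b c ha hb hc => ?_⟩
  have := (Module.Basis.mk h.indep h.span.ge).constr_basis k
    (fun t => f t.1 t.2.1 t.2.2) (⟨a, ha⟩, ⟨b, hb⟩, ⟨c, hc⟩)
  simpa using this

theorem hom_ext (h : IsBook n q g x y) {M : Type*} [AddCommGroup M] [Module k M]
    {φ φ' : H →ₗ[k] M}
    (hφ : ∀ a b c, a < n → b < n → c < n →
      φ (g ^ a * y ^ b * x ^ c) = φ' (g ^ a * y ^ b * x ^ c)) : φ = φ' := by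
  refine LinearMap.ext_on h.span ?_
  rintro _ ⟨t, rfl⟩
  exact hφ _ _ _ t.1.2 t.2.1.2 t.2.2.2

theorem x_pow_mul_y (h : IsBook n q g x y) (c : ℕ) : x ^ c * y = q ^ c • (y * x ^ c) := by
  induction c with
  | zero => simp
  | succ c ih =>
    rw [pow_succ, mul_assoc, h.xy, mul_smul_comm, ← mul_assoc, ih, smul_mul_assoc, smul_smul,
      mul_assoc, pow_succ, mul_comm]

theorem pow_sub_mul (h : IsBook n q g x y) : g ^ (n - 1) * g = 1 := by
  rw [← pow_succ, Nat.sub_add_cancel (by have := h.two_lt; omega), h.gn]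

theorem mul_pow_sub (h : IsBook n q g x y) : g * g ^ (n - 1) = 1 := by
  rw [← pow_succ', Nat.sub_add_cancel (by have := h.two_lt; omega), h.gn]

theorem x_mul_G (h : IsBook n q g x y) : x * g ^ (n - 1) = q • (g ^ (n - 1) * x) := by
  calc x * g ^ (n - 1) = g ^ (n - 1) * (g * x) * g ^ (n - 1) := by
        rw [← mul_assoc, h.pow_sub_mul, one_mul]
    _ = q • (g ^ (n - 1) * x * (g * g ^ (n - 1))) := by
        rw [h.gx]; simp only [mul_smul_comm, smul_mul_assoc, mul_assoc]
    _ = _ := by rw [h.mul_pow_sub, mul_one]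

theorem y_mul_G (h : IsBook n q g x y) : y * g ^ (n - 1) = q⁻¹ • (g ^ (n - 1) * y) := by
  calc y * g ^ (n - 1) = g ^ (n - 1) * (g * y) * g ^ (n - 1) := by
        rw [← mul_assoc, h.pow_sub_mul, one_mul]
    _ = q⁻¹ • (g ^ (n - 1) * y * (g * g ^ (n - 1))) := by
        rw [h.gy]; simp only [mul_smul_comm, smul_mul_assoc, mul_assoc]
    _ = _ := by rw [h.mul_pow_sub, mul_one]

theorem pow_mul_eq_smul {u G : H} {r : k} (hu : u * G = r • (G * u)) (a : ℕ) :
    u ^ a * G = r ^ a • (G * u ^ a) := by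
  induction a with
  | zero => simp
  | succ a ih =>
    rw [pow_succ, mul_assoc, hu, mul_smul_comm, ← mul_assoc, ih, smul_mul_assoc, smul_smul,
      mul_assoc, pow_succ, mul_comm r]

/-- The functional reading off the degree-one part, with values `px` at `x` and `py` at `y`,
behaves as a derivation relative to the counit. -/
theorem exists_derivation (h : IsBook n q g x y) (px py : k) :
    ∃ ψ : H →ₗ[k] k, (∀ u, ψ (u * x) = Coalgebra.counit (R := k) u * px) ∧
      (∀ u, ψ (u * y) = Coalgebra.counit (R := k) u * py) ∧
      ∀ a b, a < n → b < n → a + b ≠ 1 → ψ (y ^ a * x ^ b) = 0 := by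
  have h2 := h.two_lt
  obtain ⟨ψ, hψ⟩ := h.exists_functional
    (fun _ b c => if b = 0 ∧ c = 1 then px else if b = 1 ∧ c = 0 then py else 0)
  have hε : ∀ a b c, Coalgebra.counit (R := k) (g ^ a * y ^ b * x ^ c)
      = if b = 0 ∧ c = 0 then 1 else 0 := by
    intro a b c
    simp only [Bialgebra.counit_mul, Bialgebra.counit_pow, h.counit_g, h.counit_x, h.counit_y,
      one_pow, one_mul, zero_pow_eq]
    grind
  refine ⟨ψ, ?_, ?_, ?_⟩
  · suffices ψ ∘ₗ LinearMap.mulRight k x = px • Coalgebra.counit (R := k) (A := H) by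
      intro u
      have := LinearMap.congr_fun this u
      simpa [mul_comm] using this
    refine h.hom_ext fun a b c ha hb hc => ?_
    simp only [LinearMap.comp_apply, LinearMap.mulRight_apply, LinearMap.smul_apply, hε]
    rw [mul_assoc, ← pow_succ]
    rcases Nat.lt_or_ge (c + 1) n with hc' | hc'
    · rw [hψ _ _ _ ha hb hc']
      simp
    · obtain rfl : c + 1 = n := by omega
      rw [h.xn]
      have : c ≠ 0 := by omega
      simp [this]
  · suffices ψ ∘ₗ LinearMap.mulRight k y = py • Coalgebra.counit (R := k) (A := H) by
      intro u
      have := LinearMap.congr_fun this u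
      simpa [mul_comm] using this
    refine h.hom_ext fun a b c ha hb hc => ?_
    simp only [LinearMap.comp_apply, LinearMap.mulRight_apply, LinearMap.smul_apply, hε]
    rw [mul_assoc, h.x_pow_mul_y, mul_smul_comm, ← mul_assoc, mul_assoc (g ^ a), ← pow_succ,
      map_smul]
    rcases Nat.lt_or_ge (b + 1) n with hb' | hb'
    · rw [hψ _ _ _ ha hb' hc]
      rcases Nat.eq_zero_or_pos c with rfl | hc0
      · simp
      · simp [hc0.ne']
    · obtain rfl : b + 1 = n := by omega
      rw [h.yn]
      have : b ≠ 0 := by omega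
      simp [this]
  · intro a b ha hb hab
    have := hψ 0 a b (by omega) ha hb
    rw [pow_zero, one_mul] at this
    rw [this]
    grind

theorem slice_monomial (h : IsBook n q g x y) {px py : k} {ψ : H →ₗ[k] k}
    (hx : ∀ u, ψ (u * x) = Coalgebra.counit (R := k) u * px)
    (hy : ∀ u, ψ (u * y) = Coalgebra.counit (R := k) u * py) (h1 : ψ 1 = 0) (a b : ℕ) :
    slice ψ (y ^ a * x ^ b) = g ^ (n - 1) *
      ((py * ∑ i ∈ Finset.range a, q⁻¹ ^ i) • (y ^ (a - 1) * x ^ b)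
        + (px * q⁻¹ ^ a * ∑ i ∈ Finset.range b, q ^ i) • (y ^ a * x ^ (b - 1))) := by
  have hsy : ∀ a, slice ψ (y ^ a)
      = g ^ (n - 1) * ((py * ∑ i ∈ Finset.range a, q⁻¹ ^ i) • y ^ (a - 1)) := by
    intro a
    induction a with
    | zero => simp [slice, Algebra.TensorProduct.one_def, h1]
    | succ a ih =>
      rw [pow_succ, slice_mul h.comul_y hy, ih, pow_mul_eq_smul h.y_mul_G, Finset.sum_range_succ]
      rcases a with _ | a
      · simp
      · simp only [mul_smul_comm, smul_mul_assoc, mul_assoc, smul_smul, ← pow_succ,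
          Nat.add_sub_cancel, ← add_smul, mul_add]
  induction b with
  | zero => simpa using hsy a
  | succ b ih =>
    rw [pow_succ, ← mul_assoc, slice_mul h.comul_x hx, ih, mul_assoc (y ^ a),
      pow_mul_eq_smul h.x_mul_G, mul_smul_comm, ← mul_assoc (y ^ a), pow_mul_eq_smul h.y_mul_G,
      Finset.sum_range_succ]
    rcases b with _ | b
    · simp [mul_assoc, mul_add, smul_smul]
    · simp only [mul_smul_comm, smul_mul_assoc, mul_assoc, smul_smul, ← pow_succ, add_mul,
          Nat.add_sub_cancel, add_smul, mul_add, add_assoc, mul_comm (q ^ (b + 1))]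
      rfl

theorem geom_ne_zero {r : k} (hr : IsPrimitiveRoot r n) {j : ℕ} (hj : 0 < j) (hjn : j < n) :
    ∑ i ∈ Finset.range j, r ^ i ≠ 0 := by
  intro h0
  have := geom_sum_mul r j
  rw [h0, zero_mul] at this
  exact hr.pow_ne_one_of_pos_of_lt hj.ne' hjn (sub_eq_zero.1 this.symm)

/-- Homogeneous elements killed by a slice have coefficients satisfying a two-term recursion. -/
theorem coeff_recursion (h : IsBook n q g x y) {px py : k} {ψ : H →ₗ[k] k}
    (hx : ∀ u, ψ (u * x) = Coalgebra.counit (R := k) u * px)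
    (hy : ∀ u, ψ (u * y) = Coalgebra.counit (R := k) u * py) (h1 : ψ 1 = 0) {m : ℕ} (hm : m < n)
    {c : ℕ → k} (hz : slice ψ (∑ b ∈ Finset.range (m + 1), c b • (y ^ (m - b) * x ^ b)) = 0)
    {b : ℕ} (hb : b < m) :
    c b * (py * ∑ i ∈ Finset.range (m - b), q⁻¹ ^ i)
      + c (b + 1) * (px * q⁻¹ ^ (m - (b + 1)) * ∑ i ∈ Finset.range (b + 1), q ^ i) = 0 := by
  obtain ⟨φ, hφ⟩ := h.exists_functional
    (fun _ a' b' => if a' = m - 1 - b ∧ b' = b then 1 else 0)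
  have hφ' : ∀ a' b', a' < n → b' < n →
      φ (y ^ a' * x ^ b') = if a' = m - 1 - b ∧ b' = b then 1 else 0 := by
    intro a' b' ha hb
    simpa using hφ 0 a' b' (by omega) ha hb
  have hz' := congrArg (fun t => φ (g * t)) hz
  simp only [map_sum, map_smul, h.slice_monomial hx hy h1, Finset.mul_sum, mul_smul_comm,
    ← mul_assoc, h.mul_pow_sub, one_mul, mul_zero, map_zero] at hz'
  simp only [mul_assoc, ← Finset.mul_sum, map_add, map_smul, smul_eq_mul] at hz'
  rw [Finset.sum_eq_add b (b + 1) (by omega)] at hz'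
  · rw [hφ' (m - b - 1) b (by omega) (by omega), hφ' (m - b) (b - 1) (by omega) (by omega),
      hφ' (m - (b + 1) - 1) (b + 1) (by omega) (by omega),
      hφ' (m - (b + 1)) (b + 1 - 1) (by omega) (by omega),
      if_pos (by omega), if_neg (by omega), if_neg (by omega), if_pos (by omega)] at hz'
    linear_combination hz'
  · intro i hi hib
    rw [Finset.mem_range] at hi
    rw [hφ' (m - i - 1) i (by omega) (by omega), hφ' (m - i) (i - 1) (by omega) (by omega),
      if_neg (by omega), if_neg (by omega)]
    ring
  · intro hi
    exact absurd (Finset.mem_range.2 (by omega)) hi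
  · intro hi
    exact absurd (Finset.mem_range.2 (by omega)) hi

end IsBook

/-- The span of the monomials `yᵃxᵇ` of total degree `j`. -/
def monoDeg (k : Type) [Field k] {H : Type} [Ring H] [Algebra k H] (x y : H) (j : ℕ) :
    Submodule k H :=
  Submodule.span k {z | ∃ a b : ℕ, a + b = j ∧ z = y ^ a * x ^ b}

theorem mem_monoDeg_iff {x y z : H} {m : ℕ} : z ∈ monoDeg k x y m ↔
    ∃ c : ℕ → k, z = ∑ b ∈ Finset.range (m + 1), c b • (y ^ (m - b) * x ^ b) := by
  constructor
  · intro hz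
    induction hz using Submodule.span_induction with
    | mem z hz =>
      obtain ⟨a, b, hab, rfl⟩ := hz
      refine ⟨Pi.single b 1, ?_⟩
      rw [Finset.sum_eq_single b]
      · simp [← hab]
      · intro i _ hi
        simp [hi]
      · intro hb
        exact absurd (Finset.mem_range.2 (by omega)) hb
    | zero => exact ⟨0, by simp⟩
    | add u v _ _ hu hv =>
      obtain ⟨c, rfl⟩ := hu
      obtain ⟨d, rfl⟩ := hv
      exact ⟨c + d, by simp [add_smul, Finset.sum_add_distrib]⟩
    | smul r u _ hu =>
      obtain ⟨c, rfl⟩ := hu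
      exact ⟨r • c, by simp [Finset.smul_sum, smul_smul]⟩
  · rintro ⟨c, rfl⟩
    refine Submodule.sum_mem _ fun b hb => Submodule.smul_mem _ _ (Submodule.subset_span ?_)
    rw [Finset.mem_range] at hb
    exact ⟨m - b, b, by omega, rfl⟩

theorem mem_monoDeg_one_iff {x y z : H} :
    z ∈ monoDeg k x y 1 ↔ ∃ s t : k, z = s • x + t • y := by
  rw [mem_monoDeg_iff]
  constructor
  · rintro ⟨c, rfl⟩
    exact ⟨c 1, c 0, by simp [Finset.sum_range_succ, add_comm]⟩
  · rintro ⟨s, t, rfl⟩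
    exact ⟨fun b => if b = 0 then t else s, by simp [Finset.sum_range_succ, add_comm]⟩

theorem monoDeg_zero {x y : H} : monoDeg k x y 0 = Submodule.span k {1} := by
  ext z
  rw [mem_monoDeg_iff, Submodule.mem_span_singleton]
  constructor
  · rintro ⟨c, rfl⟩
    exact ⟨c 0, by simp⟩
  · rintro ⟨r, rfl⟩
    exact ⟨fun _ => r, by simp⟩

theorem pow_mem_of_mul_le {K : Submodule k H} (hK1 : (1 : H) ∈ K) (hKmul : K * K ≤ K) {w : H}
    (hw : w ∈ K) (m : ℕ) : w ^ m ∈ K := by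
  induction m with
  | zero => simpa using hK1
  | succ m ih => exact pow_succ w m ▸ hKmul (Submodule.mul_mem_mul ih hw)

namespace IsBook

variable {n : ℕ} {q : k} {g x y : H}

theorem exists_coeff_pow (h : IsBook n q g x y) (α β : k) (m : ℕ) :
    ∃ c : ℕ → k, c 0 = β ^ m ∧ c m = α ^ m ∧
      (α • x + β • y) ^ m = ∑ b ∈ Finset.range (m + 1), c b • (y ^ (m - b) * x ^ b) := by
  induction m with
  | zero => exact ⟨fun _ => 1, by simp⟩
  | succ m ih =>
    obtain ⟨c, h0, hm, hc⟩ := ih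
    refine ⟨fun b => (if b = 0 then 0 else α * c (b - 1))
      + (if b = m + 1 then 0 else β * q ^ b * c b), ?_, ?_, ?_⟩
    · simp [h0, pow_succ, mul_comm]
    · simp [hm, pow_succ, mul_comm]
    · rw [pow_succ, hc, mul_add, Finset.sum_mul, Finset.sum_mul]
      simp only [add_smul, Finset.sum_add_distrib]
      congr 1
      · rw [Finset.sum_range_succ' _ (m + 1)]
        simp [mul_assoc, smul_smul, ← pow_succ]
      · rw [Finset.sum_range_succ _ (m + 1)]
        simp only [if_true, zero_smul, add_zero]
        refine Finset.sum_congr rfl fun b hb => ?_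
        rw [Finset.mem_range] at hb
        rw [if_neg (by omega), Nat.succ_sub (by omega : b ≤ m), pow_succ]
        simp only [mul_smul_comm, smul_mul_assoc, mul_assoc, h.x_pow_mul_y, smul_smul]
        congr 1
        ring

theorem coeff_eq_zero (h : IsBook n q g x y) {s t : k} (hst : s • x + t • y = 0) :
    s = 0 ∧ t = 0 := by
  have key : ∀ px py : k, s * px + t * py = 0 := by
    intro px py
    obtain ⟨ψ, hx, hy, -⟩ := h.exists_derivation px py
    have hx1 := hx 1
    have hy1 := hy 1
    rw [one_mul, Bialgebra.counit_one, one_mul] at hx1 hy1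
    simpa [hx1, hy1] using congrArg ψ hst
  exact ⟨by simpa using key 1 0, by simpa using key 0 1⟩

/-- If the degree-one part of `K` is killed by the functional `(px, py)`, then every
homogeneous element of `K` satisfies the corresponding recursion. -/
theorem recursion_of_mem (h : IsBook n q g x y) {A : ℕ → Submodule k H} {K : Submodule k H}
    (hco : ∀ j, Submodule.map (Coalgebra.comul (R := k) (A := H)) (K ⊓ monoDeg k x y j)
      ≤ ⨆ i ∈ Finset.range (j + 1), tsub k (A i) (K ⊓ monoDeg k x y (j - i)))
    {px py : k} (hp : ∀ s t : k, s • x + t • y ∈ K → s * px + t * py = 0)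
    {m : ℕ} (hm : m < n) {c : ℕ → k}
    (hz : ∑ b ∈ Finset.range (m + 1), c b • (y ^ (m - b) * x ^ b) ∈ K) {b : ℕ} (hb : b < m) :
    c b * (py * ∑ i ∈ Finset.range (m - b), q⁻¹ ^ i)
      + c (b + 1) * (px * q⁻¹ ^ (m - (b + 1)) * ∑ i ∈ Finset.range (b + 1), q ^ i) = 0 := by
  obtain ⟨ψ, hx, hy, h0⟩ := h.exists_derivation px py
  have h1 : ψ 1 = 0 := by simpa using h0 0 0 (by omega) (by omega) (by omega)
  refine h.coeff_recursion hx hy h1 hm ?_ hb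
  refine slice_eq_zero (B := fun j => K ⊓ monoDeg k x y j)
    (hco m (Submodule.mem_map_of_mem ⟨hz, mem_monoDeg_iff.2 ⟨c, rfl⟩⟩)) ?_
  rintro j hj u ⟨huK, hu⟩
  rcases eq_or_ne j 1 with rfl | hj1
  · obtain ⟨s, t, rfl⟩ := mem_monoDeg_one_iff.1 hu
    have hx1 := hx 1
    have hy1 := hy 1
    rw [one_mul, Bialgebra.counit_one, one_mul] at hx1 hy1
    simpa [hx1, hy1] using hp s t huK
  · obtain ⟨d, rfl⟩ := mem_monoDeg_iff.1 hu
    rw [map_sum]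
    refine Finset.sum_eq_zero fun i hi => ?_
    rw [Finset.mem_range] at hi
    rw [map_smul, h0 _ _ (by omega) (by omega) (by omega), smul_zero]

theorem component_eq_bot (h : IsBook n q g x y) {A : ℕ → Submodule k H} {K : Submodule k H}
    (hco : ∀ j, Submodule.map (Coalgebra.comul (R := k) (A := H)) (K ⊓ monoDeg k x y j)
      ≤ ⨆ i ∈ Finset.range (j + 1), tsub k (A i) (K ⊓ monoDeg k x y (j - i)))
    (h1 : ∀ s t : k, s • x + t • y ∈ K → s = 0 ∧ t = 0) {m : ℕ} (hm0 : 0 < m) (hm : m < n) :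
    K ⊓ monoDeg k x y m = ⊥ := by
  rw [eq_bot_iff]
  rintro z ⟨hzK, hz⟩
  obtain ⟨c, rfl⟩ := mem_monoDeg_iff.1 hz
  refine Finset.sum_eq_zero fun b hb => ?_
  rw [Finset.mem_range] at hb
  suffices c b = 0 by rw [this, zero_smul]
  rcases Nat.lt_or_ge b m with hbm | hbm
  · have := h.recursion_of_mem hco (px := 0) (py := 1)
      (fun s t hst => by simp [h1 s t hst]) hm hzK hbm
    simpa [-inv_pow, geom_ne_zero h.prim.inv (by omega : 0 < m - b) (by omega)] using this
  · obtain ⟨b, rfl⟩ : ∃ b', b = b' + 1 := ⟨b - 1, by omega⟩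
    have := h.recursion_of_mem hco (px := 1) (py := 0)
      (fun s t hst => by simp [h1 s t hst]) hm hzK (b := b) (by omega)
    simpa [-inv_pow, h.ne_zero, geom_ne_zero h.prim (by omega : 0 < b + 1) (by omega)] using this

theorem component_le_span (h : IsBook n q g x y) {A : ℕ → Submodule k H} {K : Submodule k H}
    (hK1 : (1 : H) ∈ K) (hKmul : K * K ≤ K)
    (hco : ∀ j, Submodule.map (Coalgebra.comul (R := k) (A := H)) (K ⊓ monoDeg k x y j)
      ≤ ⨆ i ∈ Finset.range (j + 1), tsub k (A i) (K ⊓ monoDeg k x y (j - i)))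
    {α β : k} (hαβ : α ≠ 0 ∨ β ≠ 0) (hw : α • x + β • y ∈ K)
    (hdet : ∀ s t : k, s • x + t • y ∈ K → t * α - s * β = 0) {m : ℕ} (hm : m < n) :
    K ⊓ monoDeg k x y m ≤ Submodule.span k {(α • x + β • y) ^ m} := by
  rintro z ⟨hzK, hz⟩
  obtain ⟨d, hd⟩ := mem_monoDeg_iff.1 hz
  obtain ⟨e, he0, hem, he⟩ := h.exists_coeff_pow α β m
  have hwK := pow_mem_of_mul_le hK1 hKmul hw m
  have hsub : ∀ r : k, z - r • (α • x + β • y) ^ m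
      = ∑ b ∈ Finset.range (m + 1), (d b - r * e b) • (y ^ (m - b) * x ^ b) := by
    intro r
    rw [hd, he, Finset.smul_sum, ← Finset.sum_sub_distrib]
    simp only [sub_smul, smul_smul]
  have hrec : ∀ r : k, ∀ b < m,
      (d b - r * e b) * (α * ∑ i ∈ Finset.range (m - b), q⁻¹ ^ i)
        + (d (b + 1) - r * e (b + 1))
          * (-β * q⁻¹ ^ (m - (b + 1)) * ∑ i ∈ Finset.range (b + 1), q ^ i) = 0 := by
    intro r b hb
    refine h.recursion_of_mem hco (c := fun b => d b - r * e b)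
      (fun s t hst => by linear_combination hdet s t hst) hm ?_ hb
    rw [← hsub]
    exact K.sub_mem hzK (K.smul_mem _ hwK)
  suffices ∃ r : k, ∀ b ≤ m, d b - r * e b = 0 by
    obtain ⟨r, hr⟩ := this
    refine Submodule.mem_span_singleton.2 ⟨r, (sub_eq_zero.1 ?_).symm⟩
    rw [hsub]
    refine Finset.sum_eq_zero fun b hb => ?_
    rw [hr b (Nat.lt_succ_iff.1 (Finset.mem_range.1 hb)), zero_smul]
  by_cases hβ : β = 0
  · have hα : α ≠ 0 := by tauto
    refine ⟨d m / e m, fun b hb => ?_⟩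
    rcases hb.lt_or_eq with hb | rfl
    · have := hrec (d m / e m) b hb
      simpa [-inv_pow, hβ, hα,
        geom_ne_zero h.prim.inv (by omega : 0 < m - b) (by omega)] using this
    · rw [div_mul_cancel₀ _ (hem ▸ pow_ne_zero _ hα), sub_self]
  · refine ⟨d 0 / e 0, fun b hb => ?_⟩
    induction b with
    | zero => rw [div_mul_cancel₀ _ (he0 ▸ pow_ne_zero _ hβ), sub_self]
    | succ b ih =>
      have := hrec (d 0 / e 0) b hb
      rw [ih (by omega), zero_mul, zero_add] at this
      simpa [-inv_pow, hβ, h.ne_zero,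
        geom_ne_zero h.prim (by omega : 0 < b + 1) (by omega)] using this

end IsBook

end

/-- **Statement 17** (Lemma `gener-in-1`).
Let `q` be a primitive `n`-th root of unity, `n > 2`, and let `ℋ(1,q)` be the book Hopf
algebra, presented by generators `g, x, y` with relations
`gⁿ = 1, gx = q xg, gy = q⁻¹ yg, xy = q yx, xⁿ = 0 = yⁿ`, coproduct
`Δ(g) = g⊗g, Δ(x) = x⊗1 + g⁻¹⊗x, Δ(y) = y⊗1 + g⁻¹⊗y` and PBW basis `{gᵃyᵇxᶜ}`;
it is the bosonization `𝔅(V)#kCₙ` of the quantum plane, `𝔅(V)` being the span of the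
monomials `yᵇxᶜ` with grading by total degree.  If `K ⊆ 𝔅(V)` is a homogeneous left
coideal subalgebra of `ℋ(1,q)`, then `K` is generated as an algebra by its degree-one
component `K(1)`; in particular if `K(1)` is spanned by a single element `w`, then
`K(m) = k·wᵐ` for all `m`. -/
theorem stmt_17 (k : Type) [Field k] (n : ℕ) (hn : 2 < n) (q : k)
    (hq : IsPrimitiveRoot q n)
    (H : Type) [Ring H] [HopfAlgebra k H] (g x y : H)
    -- the relations of the book Hopf algebra ℋ(1,q):
    (hgx : g * x = q • (x * g)) (hgy : g * y = q⁻¹ • (y * g))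
    (hxy : x * y = q • (y * x))
    (hgn : g ^ n = 1) (hxn : x ^ n = 0) (hyn : y ^ n = 0)
    -- the coproduct and counit on the generators:
    (hΔg : Coalgebra.comul (R := k) g = g ⊗ₜ[k] g)
    (hΔx : Coalgebra.comul (R := k) x = x ⊗ₜ[k] 1 + (g ^ (n - 1)) ⊗ₜ[k] x)
    (hΔy : Coalgebra.comul (R := k) y = y ⊗ₜ[k] 1 + (g ^ (n - 1)) ⊗ₜ[k] y)
    (hεg : Coalgebra.counit (R := k) g = 1)
    (hεx : Coalgebra.counit (R := k) x = 0)
    (hεy : Coalgebra.counit (R := k) y = 0)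
    -- the PBW basis {gᵃyᵇxᶜ : 0 ≤ a,b,c < n}:
    (hbasis : LinearIndependent k
        (fun t : Fin n × Fin n × Fin n => g ^ (t.1 : ℕ) * y ^ (t.2.1 : ℕ) * x ^ (t.2.2 : ℕ)))
    (hspan : Submodule.span k
        (Set.range (fun t : Fin n × Fin n × Fin n =>
          g ^ (t.1 : ℕ) * y ^ (t.2.1 : ℕ) * x ^ (t.2.2 : ℕ))) = ⊤)
    -- the diagram 𝔅(V) = span{yᵇxᶜ} and the gradings of 𝔅(V) and of ℋ(1,q):
    (BV : Submodule k H)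
    (hBV : BV = Submodule.span k
        (Set.range (fun t : Fin n × Fin n => y ^ (t.1 : ℕ) * x ^ (t.2 : ℕ))))
    (Bdeg : ℕ → Submodule k H)
    (hBdeg : ∀ j, Bdeg j = Submodule.span k {z | ∃ a b : ℕ, a + b = j ∧ z = y ^ a * x ^ b})
    (Hdeg : ℕ → Submodule k H)
    (hHdeg : ∀ j, Hdeg j
      = Submodule.span k {z | ∃ c a b : ℕ, a + b = j ∧ z = g ^ c * (y ^ a * x ^ b)})
    -- `K ⊆ 𝔅(V)` a homogeneous left coideal subalgebra:
    (K : Submodule k H) (hK1 : (1 : H) ∈ K) (hKmul : K * K ≤ K) (hKB : K ≤ BV)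
    (hKhomog : K = ⨆ j ∈ Finset.range n, (K ⊓ Bdeg j))
    (hKcoideal : ∀ j, Submodule.map (Coalgebra.comul (R := k) (A := H)) (K ⊓ Bdeg j)
      ≤ ⨆ i ∈ Finset.range (j + 1), tsub k (Hdeg i) (K ⊓ Bdeg (j - i))) :
    -- `K` is generated as an algebra by `K(1)`:
    Subalgebra.toSubmodule (Algebra.adjoin k ((K ⊓ Bdeg 1 : Submodule k H) : Set H)) = K ∧
      -- in particular, if `K(1) = k·w` then `K(m) = k·wᵐ` for all `m`:
      ∀ w : H, (K ⊓ Bdeg 1) = Submodule.span k {w} →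
        ∀ m, m < n → (K ⊓ Bdeg m) = Submodule.span k {w ^ m} := by
  have h : IsBook n q g x y := ⟨hn, hq, hgx, hgy, hxy, hgn, hxn, hyn, hΔx, hΔy, hεg, hεx, hεy,
    hbasis, hspan⟩
  obtain rfl : Bdeg = monoDeg k x y := funext hBdeg
  have hKpow := fun {w : H} (hw : w ∈ K) => pow_mem_of_mul_le hK1 hKmul hw
  refine ⟨le_antisymm ?_ ?_, ?_⟩
  · exact Algebra.adjoin_le
      (S := K.toSubalgebra hK1 fun a b ha hb => hKmul (Submodule.mul_mem_mul ha hb))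
      fun u hu => hu.1
  · set S := Algebra.adjoin k ((K ⊓ monoDeg k x y 1 : Submodule k H) : Set H)
    have hsub : ∀ s t : k, s • x + t • y ∈ K → s • x + t • y ∈ S := fun s t hst =>
      Algebra.subset_adjoin ⟨hst, mem_monoDeg_one_iff.2 ⟨s, t, rfl⟩⟩
    have hzero : K ⊓ monoDeg k x y 0 ≤ Subalgebra.toSubmodule S := by
      rw [monoDeg_zero]
      exact inf_le_right.trans ((Submodule.span_singleton_le_iff_mem _ _).2 S.one_mem)
    by_cases hdet : ∀ α β s t : k, α • x + β • y ∈ K → s • x + t • y ∈ K → t * α - s * β = 0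
    · refine hKhomog.le.trans (iSup₂_le fun m hm => ?_)
      rw [Finset.mem_range] at hm
      by_cases hne : ∃ α β : k, (α ≠ 0 ∨ β ≠ 0) ∧ α • x + β • y ∈ K
      · obtain ⟨α, β, hαβ, hw⟩ := hne
        refine (h.component_le_span hK1 hKmul hKcoideal hαβ hw
          (fun s t => hdet α β s t hw) hm).trans ?_
        exact (Submodule.span_singleton_le_iff_mem _ _).2 (S.pow_mem (hsub α β hw) m)
      · rcases Nat.eq_zero_or_pos m with rfl | hm0
        · exact hzero
        · rw [h.component_eq_bot hKcoideal (fun s t hst => by grind) hm0 hm]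
          exact bot_le
    · push Not at hdet
      obtain ⟨α, β, s, t, hw, hv, hne⟩ := hdet
      have hxS : x ∈ S := by
        have := S.smul_mem (S.sub_mem (S.smul_mem (hsub α β hw) t) (S.smul_mem (hsub s t hv) β))
          (t * α - s * β)⁻¹
        convert this using 1
        rw [eq_inv_smul_iff₀ hne]
        module
      have hyS : y ∈ S := by
        have := S.smul_mem (S.sub_mem (S.smul_mem (hsub s t hv) α) (S.smul_mem (hsub α β hw) s))
          (t * α - s * β)⁻¹
        convert this using 1
        rw [eq_inv_smul_iff₀ hne]
        module
      refine hKB.trans (hBV ▸ Submodule.span_le.2 ?_)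
      rintro _ ⟨t, rfl⟩
      exact S.mul_mem (S.pow_mem hyS _) (S.pow_mem hxS _)
  · intro w hw m hm
    have hwmem : w ∈ K ⊓ monoDeg k x y 1 := hw ▸ Submodule.mem_span_singleton_self w
    obtain ⟨α, β, rfl⟩ := mem_monoDeg_one_iff.1 hwmem.2
    have hmul : ∀ s t : k, s • x + t • y ∈ K → ∃ r, s = r * α ∧ t = r * β := by
      intro s t hst
      have : s • x + t • y ∈ K ⊓ monoDeg k x y 1 := ⟨hst, mem_monoDeg_one_iff.2 ⟨s, t, rfl⟩⟩
      rw [hw, Submodule.mem_span_singleton] at this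
      obtain ⟨r, hr⟩ := this
      have h0 : (s - r * α) • x + (t - r * β) • y = 0 := by
        rw [← sub_eq_zero.2 hr.symm]
        module
      obtain ⟨h1, h2⟩ := h.coeff_eq_zero h0
      exact ⟨r, sub_eq_zero.1 h1, sub_eq_zero.1 h2⟩
    have hge : Submodule.span k {(α • x + β • y) ^ m} ≤ K ⊓ monoDeg k x y m := by
      obtain ⟨c, -, -, hc⟩ := h.exists_coeff_pow α β m
      exact (Submodule.span_singleton_le_iff_mem _ _).2
        ⟨hKpow hwmem.1 m, mem_monoDeg_iff.2 ⟨c, hc⟩⟩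
    refine le_antisymm ?_ hge
    by_cases hαβ : α ≠ 0 ∨ β ≠ 0
    · refine h.component_le_span hK1 hKmul hKcoideal hαβ hwmem.1 (fun s t hst => ?_) hm
      obtain ⟨r, rfl, rfl⟩ := hmul s t hst
      ring
    · rcases Nat.eq_zero_or_pos m with rfl | hm0
      · rw [monoDeg_zero, pow_zero]
        exact inf_le_right
      · rw [h.component_eq_bot hKcoideal (fun s t hst => ?_) hm0 hm]
        · exact bot_le
        · obtain ⟨r, rfl, rfl⟩ := hmul s t hst
          push Not at hαβ
          simp [hαβ]

end HopfPaper
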